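/- Let g, h ∈ SL(2,ℂ) and suppose c := det(g·e₁, h·e₁) ≠ 0, where e₁ = (1,0)ᵀ and det(v,w) denotes the determinant of the 2×2 matrix with columns v and w. Then there exist x₀, x₁ ∈ P such that (g·x₀)⁻¹·(h·x₁) = q(c), where q(c) is the matrix with rows (0, −c⁻¹) and (c, 0). -/

import Mathlib

/-- `P ⊂ SL(2,ℂ)`: the subgroup of upper triangular matrices with `1`s on the diagonal. -/
def InP (g : Matrix.SpecialLinearGroup (Fin 2) ℂ) : Prop :=
  (g : Matrix (Fin 2) (Fin 2) ℂ) 1 0 = 0 ∧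
    (g : Matrix (Fin 2) (Fin 2) ℂ) 0 0 = 1 ∧
    (g : Matrix (Fin 2) (Fin 2) ℂ) 1 1 = 1

/-- The determinant of the `2 × 2` matrix with columns `v` and `w`. -/
noncomputable def det2 (v w : Fin 2 → ℂ) : ℂ :=
  Matrix.det !![v 0, w 0; v 1, w 1]

/-- The upper unitriangular matrix with upper right entry `t`, as an element of `SL(2,ℂ)`. -/
def upperUnipotent (t : ℂ) : Matrix.SpecialLinearGroup (Fin 2) ℂ :=
  ⟨!![1, t; 0, 1], by simp [Matrix.det_fin_two]⟩

theorem coe_upperUnipotent (t : ℂ) :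
    (upperUnipotent t : Matrix (Fin 2) (Fin 2) ℂ) = !![1, t; 0, 1] := rfl

theorem inP_upperUnipotent (t : ℂ) : InP (upperUnipotent t) := by
  simp [InP, coe_upperUnipotent]

/-- The lower left entry of `g⁻¹ * h` is the Ptolemy coordinate of `g` and `h`. -/
theorem inv_mul_apply_one_zero (g h : Matrix.SpecialLinearGroup (Fin 2) ℂ) :
    ((g⁻¹ * h : Matrix.SpecialLinearGroup (Fin 2) ℂ) : Matrix (Fin 2) (Fin 2) ℂ) 1 0 =
      det2 ((g : Matrix (Fin 2) (Fin 2) ℂ).mulVec ![1, 0])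
        ((h : Matrix (Fin 2) (Fin 2) ℂ).mulVec ![1, 0]) := by
  simp [det2, Matrix.det_fin_two, Matrix.mulVec, dotProduct, Matrix.mul_apply,
    Matrix.adjugate_fin_two, Fin.sum_univ_two]
  ring

/-- Bruhat normal form of an element of `SL(2,ℂ)` with nonzero lower left entry. -/
theorem exists_upperUnipotent_inv_mul_mul_eq (m : Matrix.SpecialLinearGroup (Fin 2) ℂ)
    (hm : m 1 0 ≠ 0) :
    ∃ s t : ℂ, (((upperUnipotent s)⁻¹ * m * upperUnipotent t :
        Matrix.SpecialLinearGroup (Fin 2) ℂ) : Matrix (Fin 2) (Fin 2) ℂ) =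
      !![0, -(m 1 0)⁻¹; m 1 0, 0] := by
  refine ⟨m 0 0 / m 1 0, -(m 1 1 / m 1 0), ?_⟩
  have hdet := m.det_coe
  rw [Matrix.det_fin_two] at hdet
  rw [Matrix.SpecialLinearGroup.coe_mul, Matrix.SpecialLinearGroup.coe_mul,
    Matrix.SpecialLinearGroup.coe_inv, coe_upperUnipotent, coe_upperUnipotent,
    Matrix.adjugate_fin_two_of, Matrix.eta_fin_two (m : Matrix (Fin 2) (Fin 2) ℂ)]
  ext i j
  fin_cases i <;> fin_cases j <;> simp [Matrix.mul_apply, Fin.sum_univ_two] <;> field_simp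
  · ring
  · linear_combination -hdet
  · ring

/-- If the Ptolemy coordinate `c = det(g·e₁, h·e₁)` is nonzero, then there are coset
representatives `g * x₀` and `h * x₁` (with `x₀, x₁ ∈ P`) such that
`(g * x₀)⁻¹ * (h * x₁) = q(c) = [[0, -c⁻¹], [c, 0]]`. -/
theorem long_edge_label_eq_q_of_ptolemy (g h : Matrix.SpecialLinearGroup (Fin 2) ℂ)
    (c : ℂ)
    (hc : c = det2 ((g : Matrix (Fin 2) (Fin 2) ℂ).mulVec ![1, 0])
        ((h : Matrix (Fin 2) (Fin 2) ℂ).mulVec ![1, 0]))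
    (hc0 : c ≠ 0) :
    ∃ x₀ x₁ : Matrix.SpecialLinearGroup (Fin 2) ℂ, InP x₀ ∧ InP x₁ ∧
      (((g * x₀)⁻¹ * (h * x₁) : Matrix.SpecialLinearGroup (Fin 2) ℂ) :
          Matrix (Fin 2) (Fin 2) ℂ) = !![0, -c⁻¹; c, 0] := by
  have hm := (inv_mul_apply_one_zero g h).trans hc.symm
  obtain ⟨s, t, hst⟩ := exists_upperUnipotent_inv_mul_mul_eq (g⁻¹ * h) (by rwa [hm])
  rw [hm] at hst
  refine ⟨upperUnipotent s, upperUnipotent t, inP_upperUnipotent s, inP_upperUnipotent t, ?_⟩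
  rw [← hst, mul_inv_rev]
  simp only [mul_assoc]
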